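/- All four roots (counted with multiplicity) of the univariate quartic polynomial r4(x) = x⁴ − 1.438 x³ + 0.611 x² − 0.070 x + 0.002 (with the displayed exact rational coefficients) are real and positive; that is, r4 has four positive real roots counted with multiplicity. -/

import Mathlib

open Polynomial

/-- The quartic `r4 = x⁴ − 1.438 x³ + 0.611 x² − 0.070 x + 0.002`
(exact rational coefficients). -/
noncomputable def r4 : Polynomial ℝ :=
  X ^ 4 - C (1438 / 1000) * X ^ 3 + C (611 / 1000) * X ^ 2
    - C (70 / 1000) * X + C (2 / 1000)

theorem r4_eval (x : ℝ) :
    r4.eval x = x ^ 4 - 1438 / 1000 * x ^ 3 + 611 / 1000 * x ^ 2 - 70 / 1000 * x + 2 / 1000 := by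
  simp [r4]

theorem r4_natDegree : r4.natDegree = 4 := by
  unfold r4
  compute_degree!

theorem r4_ne_zero : r4 ≠ 0 :=
  ne_zero_of_natDegree_gt (n := 0) (by rw [r4_natDegree]; norm_num)

/-- A real polynomial taking values of opposite signs at `a < b` has a root in `(a, b)`. -/
theorem exists_mem_roots_of_eval_mul_neg {p : ℝ[X]} {a b : ℝ} (hab : a < b)
    (h : p.eval a * p.eval b < 0) : ∃ x ∈ p.roots, a < x ∧ x < b := by
  have hp : p ≠ 0 := by
    rintro rfl
    simp at h
  have hc : ContinuousOn (fun x => p.eval x) (Set.Icc a b) := p.continuous.continuousOn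
  obtain ⟨x, hx, hx0⟩ : ∃ x ∈ Set.Ioo a b, p.eval x = 0 := by
    rcases mul_neg_iff.mp h with ⟨ha, hb⟩ | ⟨ha, hb⟩
    · exact intermediate_value_Ioo' hab.le hc ⟨hb, ha⟩
    · exact intermediate_value_Ioo hab.le hc ⟨ha, hb⟩
  exact ⟨x, (mem_roots hp).mpr hx0, hx.1, hx.2⟩

/-- All four roots of `r4` (counted with multiplicity) are real and positive:
`r4` has exactly four real roots with multiplicity, all of which are positive. -/
theorem stmt12 : Multiset.card r4.roots = 4 ∧ ∀ x ∈ r4.roots, 0 < x := by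
  refine ⟨le_antisymm (r4_natDegree ▸ card_roots' r4) ?_, fun x hx => ?_⟩
  · obtain ⟨a, ha, ha0, ha1⟩ := exists_mem_roots_of_eval_mul_neg (p := r4) (a := 0) (b := 8 / 100)
      (by norm_num) (by norm_num [r4_eval])
    obtain ⟨b, hb, hb0, hb1⟩ := exists_mem_roots_of_eval_mul_neg (p := r4) (a := 8 / 100)
      (b := 3 / 10) (by norm_num) (by norm_num [r4_eval])
    obtain ⟨c, hc, hc0, hc1⟩ := exists_mem_roots_of_eval_mul_neg (p := r4) (a := 3 / 10)
      (b := 65 / 100) (by norm_num) (by norm_num [r4_eval])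
    obtain ⟨d, hd, hd0, hd1⟩ := exists_mem_roots_of_eval_mul_neg (p := r4) (a := 65 / 100)
      (b := 1) (by norm_num) (by norm_num [r4_eval])
    have hab : a < b := by linarith
    have hbc : b < c := by linarith
    have hcd : c < d := by linarith
    have hcard : ({a, b, c, d} : Finset ℝ).card = 4 := by
      have hac := hab.trans hbc
      have hbd := hbc.trans hcd
      simp [hab.ne, hac.ne, (hac.trans hcd).ne, hbc.ne, hbd.ne, hcd.ne]
    have hsub : ({a, b, c, d} : Finset ℝ).val ⊆ r4.roots := by
      intro x hx
      simp only [Finset.mem_val, Finset.mem_insert, Finset.mem_singleton] at hx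
      rcases hx with rfl | rfl | rfl | rfl <;> assumption
    rw [← hcard]
    exact Multiset.card_le_card ((Multiset.le_iff_subset (Finset.nodup _)).mpr hsub)
  · have h0 : r4.eval x = 0 := (mem_roots r4_ne_zero).mp hx
    rw [r4_eval] at h0
    by_contra! hneg
    obtain ⟨y, hy, rfl⟩ : ∃ y : ℝ, 0 ≤ y ∧ x = -y := ⟨-x, by linarith, by ring⟩
    have hpos : 0 < y ^ 4 + 1438 / 1000 * y ^ 3 + 611 / 1000 * y ^ 2 + 70 / 1000 * y
        + 2 / 1000 := by positivity
    linarith
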